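/- Let (x^k) and (g^k) be sequences in ℝ^n such that Σ_{k=1}^∞ ‖x^{k+1} − x^k‖ · ‖g^k‖ < ∞ and liminf_{k→∞} ‖g^k‖ = 0. If x̄ ∈ ℝ^n is a cluster point of (x^k) (i.e., some subsequence of (x^k) converges to x̄), then liminf_{k→∞} max{‖x^k − x̄‖, ‖g^k‖} = 0. -/

import Mathlib

open Filter Topology

/-- If `∑ dist (x (k + 1)) (x k) * r k` converges, `a` is a cluster point of `x`, and `r` is at
least `ε` whenever `x` is `ε`-close to `a` (far out in the sequence), then `x` is eventually trapped
near `a`, so `r` is eventually at least `ε`. -/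
theorem eventually_le_of_eventually_le_max_dist {X : Type*} [PseudoMetricSpace X]
    {x : ℕ → X} {r : ℕ → ℝ} {a : X} {ε : ℝ} (hr : ∀ k, 0 ≤ r k)
    (hsum : Summable fun k => dist (x (k + 1)) (x k) * r k)
    (ha : MapClusterPt a atTop x) (hε : 0 < ε)
    (h : ∀ᶠ k in atTop, ε ≤ max (dist (x k) a) (r k)) :
    ∀ᶠ k in atTop, ε ≤ r k := by
  set S : ℕ → ℝ := fun m => ∑ k ∈ Finset.range m, dist (x (k + 1)) (x k) * r k
  set T : ℝ := ∑' k, dist (x (k + 1)) (x k) * r k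
  have hS_le (m : ℕ) : S m ≤ T :=
    hsum.sum_le_tsum _ fun k _ => mul_nonneg dist_nonneg (hr k)
  have hS_gt : ∀ᶠ m in atTop, T - ε / 2 * ε < S m :=
    hsum.hasSum.tendsto_sum_nat.eventually_const_lt (by simp only [T]; nlinarith)
  have hnear : ∃ᶠ k in atTop, dist (x k) a < ε / 2 :=
    ha.frequently (Metric.ball_mem_nhds a (half_pos hε))
  obtain ⟨p, hp, hpS, hpmax⟩ :=
    (hnear.and_eventually (hS_gt.and (eventually_forall_ge_atTop.mpr h))).exists
  have hclose {m : ℕ} (hm : dist (x m) (x p) * ε ≤ S m - S p) : dist (x m) a < ε := by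
    have hlt : dist (x m) (x p) < ε / 2 :=
      lt_of_mul_lt_mul_right (by linarith [hS_le m]) hε.le
    linarith [dist_triangle (x m) (x p) a]
  have hr_ge {m : ℕ} (hpm : p ≤ m) (hm : dist (x m) (x p) * ε ≤ S m - S p) : ε ≤ r m :=
    (le_max_iff.mp (hpmax m hpm)).resolve_left (hclose hm).not_ge
  have htrap (m : ℕ) (hpm : p ≤ m) : dist (x m) (x p) * ε ≤ S m - S p := by
    induction m, hpm using Nat.le_induction with
    | base => simp
    | succ m hpm ih =>
      have hstep : S (m + 1) = S m + dist (x (m + 1)) (x m) * r m := Finset.sum_range_succ _ _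
      have htri := mul_le_mul_of_nonneg_right (dist_triangle (x (m + 1)) (x m) (x p)) hε.le
      have hmul := mul_le_mul_of_nonneg_left (hr_ge hpm ih)
        (dist_nonneg (x := x (m + 1)) (y := x m))
      linarith
  filter_upwards [eventually_ge_atTop p] with m hpm using hr_ge hpm (htrap m hpm)

/-- If `Σ ‖x^{k+1} − x^k‖ ‖g^k‖ < ∞` and `liminf ‖g^k‖ = 0`, then for
every cluster point `x̄` of `(x^k)` we have `liminf max{‖x^k − x̄‖, ‖g^k‖} = 0`. -/
theorem stmt_17 (n : ℕ) (x g : ℕ → EuclideanSpace ℝ (Fin n))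
    (hsum : Summable fun k => ‖x (k + 1) - x k‖ * ‖g k‖)
    (hliminf : Filter.liminf (fun k => ‖g k‖) Filter.atTop = 0)
    (xbar : EuclideanSpace ℝ (Fin n))
    (hcluster : ∃ φ : ℕ → ℕ, StrictMono φ ∧
      Filter.Tendsto (fun k => x (φ k)) Filter.atTop (nhds xbar)) :
    Filter.liminf (fun k => max ‖x k - xbar‖ ‖g k‖) Filter.atTop = 0 := by
  obtain ⟨φ, hφ, hx⟩ := hcluster
  have ha : MapClusterPt xbar atTop x := hx.mapClusterPt.of_comp hφ.tendsto_atTop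
  simp only [← dist_eq_norm] at hsum ⊢
  rw [← hliminf, liminf_eq, liminf_eq]
  congr 1
  ext ε
  refine ⟨fun h => ?_, fun h => h.mono fun k hk => hk.trans (le_max_right _ _)⟩
  rcases le_or_gt ε 0 with hε | hε
  · exact .of_forall fun k => hε.trans (norm_nonneg _)
  · exact eventually_le_of_eventually_le_max_dist (fun k => norm_nonneg _) hsum ha hε h
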